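/- Let L be a finite semidistributive lattice with exactly k atoms. Then the order dimension of L is at least k; that is, whenever ≤_1, …, ≤_d are linear orders on the underlying set of L, each extending the order of L, such that for all p, q one has p ≤ q in L if and only if p ≤_i q for all i ∈ [d], then d ≥ k. -/

import Mathlib

/-- a finite semidistributive lattice with exactly `k` atoms has
order dimension at least `k`: any realization of its order as the intersection of `d`
linear extensions needs `d ≥ k`. -/
theorem semidistributive_order_dimension (L : Type*) [Lattice L] [Fintype L]
    [OrderBot L] (k : ℕ)
    (hSD_join : ∀ p q r : L, p ⊔ q = p ⊔ r → p ⊔ q = p ⊔ (q ⊓ r))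
    (hSD_meet : ∀ p q r : L, p ⊓ q = p ⊓ r → p ⊓ q = p ⊓ (q ⊔ r))
    (hAtoms : {a : L | IsAtom a}.ncard = k)
    (d : ℕ) (ord : Fin d → LinearOrder L)
    (hext : ∀ i, ∀ p q : L, p ≤ q → (ord i).le p q)
    (hint : ∀ p q : L, p ≤ q ↔ ∀ i, (ord i).le p q) :
    k ≤ d := by
  classical
  have hstar : ∀ a : L, ∃ m : L, a ⊓ m = ⊥ ∧ ∀ x, a ⊓ x = ⊥ → x ≤ m := by
    intro a
    refine ⟨(Finset.univ.filter (fun x : L => a ⊓ x = ⊥)).sup id, ?_, ?_⟩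
    · refine Finset.sup_induction (p := fun m : L => a ⊓ m = ⊥) ?_ ?_ ?_
      · exact inf_bot_eq a
      · intro x hx y hy
        have h := hSD_meet a x y (hx.trans hy.symm)
        exact h.symm.trans hx
      · intro x hx
        exact (Finset.mem_filter.mp hx).2
    · intro x hx
      exact Finset.le_sup (f := id) (Finset.mem_filter.mpr ⟨Finset.mem_univ x, hx⟩)
  choose m hm hmax using hstar
  have hidx : ∀ a : {a : L | IsAtom a}, ∃ i, ¬ (ord i).le a.1 (m a.1) := by
    intro a
    by_contra hcon
    push Not at hcon
    have hle : a.1 ≤ m a.1 := (hint _ _).2 hcon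
    have h := hm a.1
    rw [inf_eq_left.mpr hle] at h
    exact a.2.1 h
  choose f hf using hidx
  have hinj : Function.Injective f := by
    intro a b hab
    by_contra hne
    have hne' : a.1 ≠ b.1 := fun h => hne (Subtype.ext h)
    have hd : a.1 ⊓ b.1 = ⊥ := (a.2.disjoint_of_ne b.2 hne').eq_bot
    have h1 := hext (f a) _ _ (hmax a.1 b.1 hd)
    have h2 := hext (f a) _ _ (hmax b.1 a.1 (by rw [inf_comm]; exact hd))
    have h3 := hf a
    have h4 := hf b
    rw [← hab] at h4
    rcases (ord (f a)).le_total a.1 b.1 with h | h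
    · exact h3 ((ord (f a)).le_trans _ _ _ h h1)
    · exact h4 ((ord (f a)).le_trans _ _ _ h h2)
  rw [← hAtoms, ← Nat.card_coe_set_eq]
  simpa using Nat.card_le_card_of_injective f hinj
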